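/- arXiv:hep-th/9605076 — 2 statements merged into one kernel-verified Lean document; each statement's English description precedes it below -/
import Mathlib

section
/- Step (i) of the induction: Let the indices run over {0,1,…,n} and let L^{αβ}_A be first-order functions, symmetric in α,β, satisfying (int1). Then ∂^0_B L^{00}_A = ∂^0_A L^{00}_B for all A, B, and consequently the function V^0 = (1/2) ∫_0^1 Σ_C ψ^C_0 (L^{00}_C ∘ φ_s) ds satisfies ∂^0_A V^0 = (1/2) L^{00}_A for all A. -/
/-!
Step (i) of the induction: with indices running over `{0,1,…,n}`, (int1)
implies `∂⁰_B L^{00}_A = ∂⁰_A L^{00}_B`, and consequently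
`V⁰ = (1/2) ∫₀¹ Σ_C ψᶜ₀ (L^{00}_C ∘ φ_s) ds` satisfies
`∂⁰_A V⁰ = (1/2) L^{00}_A`.
-/

/-- The first-order jet-type space with `n+1` base indices:
`J = ℝ^{n+1} × ℝ^N × ℝ^{N×(n+1)}`. -/
abbrev J (n N : ℕ) : Type :=
  (Fin (n+1) → ℝ) × (Fin N → ℝ) × (Fin N → Fin (n+1) → ℝ)

/-- `∂ᵅ_A f`: the partial derivative with respect to the variable `ψᴬ_α`. -/
noncomputable def pd {n N : ℕ} (A : Fin N) (α : Fin (n+1)) (f : J n N → ℝ) :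
    J n N → ℝ :=
  fun p => fderiv ℝ f p (0, 0, Pi.single A (Pi.single α (1 : ℝ)))

/-- `φ_s : J → J`, fixing all coordinates except `ψᴬ₀ ↦ s ψᴬ₀`. -/
def phi {n N : ℕ} (s : ℝ) (p : J n N) : J n N :=
  (p.1, p.2.1, fun A α => if α = 0 then s * p.2.2 A α else p.2.2 A α)

open Set Metric in
/-- Differentiation under an interval integral of a jointly `C¹` integrand. -/
theorem hasFDerivAt_intervalIntegral_of_contDiff {E F : Type*} [NormedAddCommGroup E]
    [NormedSpace ℝ E] [ProperSpace E] [NormedAddCommGroup F] [NormedSpace ℝ F]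
    {G : E × ℝ → F} (hG : ContDiff ℝ 1 G) (a b : ℝ) (p : E) :
    HasFDerivAt (fun q => ∫ s in a..b, G (q, s))
      (∫ s in a..b, (fderiv ℝ G (p, s)).comp (ContinuousLinearMap.inl ℝ E ℝ)) p := by
  have hcont : Continuous fun z : E × ℝ =>
      (fderiv ℝ G z).comp (ContinuousLinearMap.inl ℝ E ℝ) :=
    (hG.continuous_fderiv one_ne_zero).clm_comp continuous_const
  obtain ⟨c, hc⟩ := ((isCompact_closedBall p 1).prod (isCompact_uIcc (a := a) (b := b))
    ).exists_bound_of_continuousOn hcont.continuousOn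
  refine intervalIntegral.hasFDerivAt_integral_of_dominated_of_fderiv_le
    (F := fun q s => G (q, s))
    (F' := fun q s => (fderiv ℝ G (q, s)).comp (ContinuousLinearMap.inl ℝ E ℝ))
    (bound := fun _ => c) (closedBall_mem_nhds p one_pos) ?_ ?_ ?_ ?_ ?_ ?_
  · exact .of_forall fun q => (hG.continuous.comp (by fun_prop)).aestronglyMeasurable
  · exact (hG.continuous.comp (by fun_prop)).intervalIntegrable _ _
  · exact (hcont.comp (by fun_prop : Continuous fun s : ℝ => (p, s))).aestronglyMeasurable
  · exact .of_forall fun s hs q hq => hc (q, s) ⟨hq, uIoc_subset_uIcc hs⟩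
  · exact intervalIntegrable_const
  · exact .of_forall fun s _ q _ =>
      ((hG.differentiable one_ne_zero) (q, s)).hasFDerivAt.comp q (hasFDerivAt_prodMk_left q s)

/-- The derivative in direction `v` of the interval integral of a jointly `C¹` integrand. -/
theorem fderiv_intervalIntegral_apply_of_contDiff {E F : Type*} [NormedAddCommGroup E]
    [NormedSpace ℝ E] [ProperSpace E] [NormedAddCommGroup F] [NormedSpace ℝ F] [CompleteSpace F]
    {G : E × ℝ → F} (hG : ContDiff ℝ 1 G) (a b : ℝ) (p v : E) :
    fderiv ℝ (fun q => ∫ s in a..b, G (q, s)) p v =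
      ∫ s in a..b, fderiv ℝ (fun q => G (q, s)) p v := by
  have hcont : Continuous fun s : ℝ =>
      (fderiv ℝ G (p, s)).comp (ContinuousLinearMap.inl ℝ E ℝ) :=
    ((hG.continuous_fderiv one_ne_zero).comp (by fun_prop)).clm_comp continuous_const
  rw [(hasFDerivAt_intervalIntegral_of_contDiff hG a b p).fderiv,
    ContinuousLinearMap.intervalIntegral_apply (hcont.intervalIntegrable _ _)]
  refine intervalIntegral.integral_congr fun s _ => ?_
  have h : HasFDerivAt (fun q => G (q, s))
      ((fderiv ℝ G (p, s)).comp (ContinuousLinearMap.inl ℝ E ℝ)) p :=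
    ((hG.differentiable one_ne_zero) (p, s)).hasFDerivAt.comp p (hasFDerivAt_prodMk_left p s)
  exact congrArg (· v) h.fderiv.symm

/-- The Poincaré lemma along the directions `e i`, with dual coordinates `l i`: the homotopy
integral of a family `f` with symmetric derivatives is a potential of `f` in these directions. -/
theorem fderiv_integral_sum_mul_eq_of_fderiv_symm {E ι : Type*} [NormedAddCommGroup E]
    [NormedSpace ℝ E] [ProperSpace E] [Fintype ι] [DecidableEq ι]
    {f : ι → E → ℝ} (hf : ∀ i, ContDiff ℝ 1 (f i)) (e : ι → E) (l : ι → E →L[ℝ] ℝ)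
    (hl : ∀ i j, l i (e j) = if i = j then 1 else 0)
    (hsymm : ∀ i j p, fderiv ℝ (f i) p (e j) = fderiv ℝ (f j) p (e i)) (i : ι) (p : E) :
    DifferentiableAt ℝ
      (fun q => ∫ s in (0 : ℝ)..1, ∑ j, l j q * f j (q + (s - 1) • ∑ k, l k q • e k)) p ∧
    fderiv ℝ
      (fun q => ∫ s in (0 : ℝ)..1, ∑ j, l j q * f j (q + (s - 1) • ∑ k, l k q • e k)) p (e i) =
      f i p := by
  have hG : ContDiff ℝ 1 fun z : E × ℝ =>
      ∑ j, l j z.1 * f j (z.1 + (z.2 - 1) • ∑ k, l k z.1 • e k) := by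
    refine ContDiff.sum fun j _ => ?_
    exact ContDiff.mul (by fun_prop) ((hf j).comp (by fun_prop))
  refine ⟨(hasFDerivAt_intervalIntegral_of_contDiff hG 0 1 p).differentiableAt, ?_⟩
  rw [fderiv_intervalIntegral_apply_of_contDiff hG]
  set w : E := ∑ k, l k p • e k with hw
  have hfd : ∀ j x, HasFDerivAt (f j) (fderiv ℝ (f j) x) x := fun j x =>
    ((hf j).differentiable one_ne_zero x).hasFDerivAt
  have hpath : ∀ s : ℝ, HasDerivAt (fun s : ℝ => p + (s - 1) • w) w s := fun s => by
    simpa using (((hasDerivAt_id s).sub_const 1).smul_const w).const_add p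
  have hF : ∀ s : ℝ, HasDerivAt (fun s : ℝ => s * f i (p + (s - 1) • w))
      (f i (p + (s - 1) • w) + s * fderiv ℝ (f i) (p + (s - 1) • w) w) s := fun s => by
    have h := (hasDerivAt_id' s).fun_mul ((hfd i _).comp_hasDerivAt s (hpath s))
    rwa [one_mul] at h
  have hint : ∀ s : ℝ, fderiv ℝ
      (fun q => ∑ j, l j q * f j (q + (s - 1) • ∑ k, l k q • e k)) p (e i) =
      f i (p + (s - 1) • w) + s * fderiv ℝ (f i) (p + (s - 1) • w) w := fun s => by
    have hline : HasFDerivAt (fun q : E => q + (s - 1) • ∑ k, l k q • e k)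
        (ContinuousLinearMap.id ℝ E + (s - 1) • ∑ k, (l k).smulRight (e k)) p :=
      (hasFDerivAt_id p).add
        ((HasFDerivAt.fun_sum fun k _ => (l k).hasFDerivAt.smul_const (e k)).const_smul (s - 1))
    have hdir : (ContinuousLinearMap.id ℝ E + (s - 1) • ∑ k, (l k).smulRight (e k)) (e i) =
        s • e i := by
      simp [hl, sub_smul]
    have h := HasFDerivAt.fun_sum (u := Finset.univ) fun j _ =>
      (l j).hasFDerivAt.mul ((hfd j _).comp p hline)
    refine (congrArg (· (e i)) h.fderiv).trans ?_
    simp only [sum_apply, add_apply, smul_apply, ContinuousLinearMap.comp_apply, hdir, map_smul, hl,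
      smul_eq_mul, Function.comp_apply, ← hw, hsymm _ i, Finset.sum_add_distrib, mul_ite, mul_one,
      mul_zero, Finset.sum_ite_eq', Finset.mem_univ, if_true]
    rw [add_comm, hw, map_sum, Finset.mul_sum]
    simp only [map_smul, smul_eq_mul, mul_left_comm]
  simp only [hint]
  have hcont : Continuous fun s : ℝ =>
      f i (p + (s - 1) • w) + s * fderiv ℝ (f i) (p + (s - 1) • w) w :=
    ((hf i).continuous.comp (by fun_prop)).add (continuous_id.mul
      ((((hf i).continuous_fderiv one_ne_zero).comp (by fun_prop)).clm_apply continuous_const))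
  rw [intervalIntegral.integral_eq_sub_of_hasDerivAt (fun s _ => hF s)
    (hcont.intervalIntegrable _ _)]
  simp

/-- The coordinate function `ψᴬ_α` on `J`. -/
noncomputable def jetCoord {n N : ℕ} (A : Fin N) (α : Fin (n+1)) : J n N →L[ℝ] ℝ :=
  (ContinuousLinearMap.proj (R := ℝ) (φ := fun _ : Fin (n+1) => ℝ) α).comp
    ((ContinuousLinearMap.proj (R := ℝ) (φ := fun _ : Fin N => Fin (n+1) → ℝ) A).comp
      ((ContinuousLinearMap.snd ℝ _ _).comp (ContinuousLinearMap.snd ℝ _ _)))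

theorem jetCoord_apply {n N : ℕ} (A : Fin N) (α : Fin (n+1)) (p : J n N) :
    jetCoord A α p = p.2.2 A α := rfl

theorem phi_eq_add_smul {n N : ℕ} (s : ℝ) (p : J n N) :
    phi s p = p + (s - 1) • ∑ C, jetCoord C 0 p •
      ((0, 0, Pi.single C (Pi.single 0 (1 : ℝ))) : J n N) := by
  have h : (∑ C, jetCoord C 0 p • ((0, 0, Pi.single C (Pi.single 0 (1 : ℝ))) : J n N)) =
      (0, 0, fun A α => if α = 0 then p.2.2 A α else 0) := by
    refine Prod.ext ?_ (Prod.ext ?_ ?_)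
    · simp [Prod.fst_sum]
    · simp [Prod.fst_sum, Prod.snd_sum]
    · ext A α
      simp only [Prod.snd_sum, Prod.smul_snd, Finset.sum_apply, Pi.smul_apply, Pi.single_apply,
        jetCoord_apply, smul_eq_mul]
      rw [Finset.sum_eq_single A]
      · by_cases hα : α = 0 <;> simp [hα]
      · intro C _ hC
        simp [hC.symm]
      · simp
  rw [h]
  refine Prod.ext ?_ (Prod.ext ?_ ?_)
  · simp [phi]
  · simp [phi]
  · ext A α
    by_cases hα : α = 0
    · simp [phi, hα]; ring
    · simp [phi, hα]

theorem step_i (n N : ℕ) (hn : 0 < n) (hN : 0 < N)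
    (L : Fin (n+1) → Fin (n+1) → Fin N → J n N → ℝ)
    (hLsmooth : ∀ α β A, ContDiff ℝ (⊤ : ℕ∞) (L α β A))
    (hLsym : ∀ α β A, L α β A = L β α A)
    (hint1 : ∀ (μ ν ρ : Fin (n+1)) (A B : Fin N) (p : J n N),
      pd B ρ (L μ ν A) p + pd B μ (L ρ ν A) p + pd B ν (L μ ρ A) p =
      pd A ρ (L μ ν B) p + pd A μ (L ρ ν B) p + pd A ν (L μ ρ B) p) :
    (∀ (A B : Fin N) (p : J n N),
      pd B 0 (L 0 0 A) p = pd A 0 (L 0 0 B) p) ∧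
    (∀ (A : Fin N) (p : J n N),
      pd A 0 (fun q => (1/2) * ∫ s in (0:ℝ)..1, ∑ C, q.2.2 C 0 * L 0 0 C (phi s q)) p
        = (1/2) * L 0 0 A p) := by
  have hsymm : ∀ (A B : Fin N) (p : J n N), pd B 0 (L 0 0 A) p = pd A 0 (L 0 0 B) p := by
    intro A B p
    linarith [hint1 0 0 0 A B p]
  refine ⟨hsymm, fun A p => ?_⟩
  obtain ⟨hd, hV⟩ := fderiv_integral_sum_mul_eq_of_fderiv_symm
    (f := fun C => L 0 0 C) (fun C => (hLsmooth 0 0 C).of_le (by exact_mod_cast le_top))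
    (fun C => ((0, 0, Pi.single C (Pi.single 0 (1 : ℝ))) : J n N)) (fun C => jetCoord C 0)
    (fun C D => by
      by_cases h : C = D
      · simp [jetCoord_apply, h]
      · simp [jetCoord_apply, h])
    hsymm A p
  simp only [← phi_eq_add_smul] at hd hV
  simp only [jetCoord_apply] at hd hV
  rw [pd, fderiv_const_mul hd, smul_apply, hV, smul_eq_mul]
end

section
/- Step (ii), integrability conditions: Let the indices run over {0,1,…,n} and let L^{αβ}_A be first-order functions, symmetric in α,β, satisfying (int1) and (int2). For latin indices i,j ∈ {1,…,n}, define T^{ij}_{AB} = ∂^i_B L^{0j}_A + ∂^j_B L^{0i}_A − ∂^0_A L^{ij}_B. Then for all latin indices i,j,k,l ∈ {1,…,n} and all A,B,C,D: (a) T^{ij}_{AB} = T^{ji}_{AB}; (b) T^{ij}_{AB} = T^{ij}_{BA}; (c) ∂^k_C T^{ij}_{AB} + ∂^k_B T^{ij}_{AC} = ∂^i_A T^{kj}_{BC} + ∂^j_A T^{ki}_{BC}; (d) (∂^i_B ∂^j_C + ∂^j_B ∂^i_C) T^{kl}_{AD} = (∂^k_A ∂^l_D + ∂^l_A ∂^k_D)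 T^{ij}_{BC}. -/
/-- `T^{ij}_{AB} = ∂ⁱ_B L^{0j}_A + ∂ʲ_B L^{0i}_A − ∂⁰_A L^{ij}_B`
(latin indices `i, j` are the indices `1,…,n`, realized via `Fin.succ`). -/
noncomputable def Tc {n N : ℕ}
    (L : Fin (n+1) → Fin (n+1) → Fin N → J n N → ℝ)
    (i j : Fin n) (A B : Fin N) : J n N → ℝ :=
  fun p => pd B i.succ (L 0 j.succ A) p + pd B j.succ (L 0 i.succ A) p
    - pd A 0 (L i.succ j.succ B) p

theorem contDiff_pd {n N : ℕ} {f : J n N → ℝ} (hf : ContDiff ℝ (⊤ : ℕ∞) f)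
    (A : Fin N) (α : Fin (n+1)) : ContDiff ℝ (⊤ : ℕ∞) (pd A α f) :=
  (hf.fderiv_right (m := (⊤ : ℕ∞)) (by simp)).clm_apply contDiff_const

theorem differentiable_of_smooth {n N : ℕ} {f : J n N → ℝ} (hf : ContDiff ℝ (⊤ : ℕ∞) f) :
    Differentiable ℝ f :=
  hf.differentiable (by simp)

theorem pd_add {n N : ℕ} {f g : J n N → ℝ} (hf : ContDiff ℝ (⊤ : ℕ∞) f)
    (hg : ContDiff ℝ (⊤ : ℕ∞) g) (A : Fin N) (α : Fin (n+1)) (p : J n N) :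
    pd A α (fun q => f q + g q) p = pd A α f p + pd A α g p := by
  simp only [pd]
  rw [fderiv_fun_add (differentiable_of_smooth hf p) (differentiable_of_smooth hg p)]
  rfl

theorem pd_sub {n N : ℕ} {f g : J n N → ℝ} (hf : ContDiff ℝ (⊤ : ℕ∞) f)
    (hg : ContDiff ℝ (⊤ : ℕ∞) g) (A : Fin N) (α : Fin (n+1)) (p : J n N) :
    pd A α (fun q => f q - g q) p = pd A α f p - pd A α g p := by
  simp only [pd]
  rw [fderiv_fun_sub (differentiable_of_smooth hf p) (differentiable_of_smooth hg p)]
  rfl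

/-- Mixed partial derivatives of a smooth function commute. -/
theorem pd_comm {n N : ℕ} {f : J n N → ℝ} (hf : ContDiff ℝ (⊤ : ℕ∞) f)
    (A B : Fin N) (α β : Fin (n+1)) (p : J n N) :
    pd A α (pd B β f) p = pd B β (pd A α f) p := by
  have hd : DifferentiableAt ℝ (fderiv ℝ f) p :=
    (hf.fderiv_right (m := (⊤ : ℕ∞)) (by simp)).differentiable (by simp) p
  have key : ∀ v w : J n N,
      fderiv ℝ (fun q => fderiv ℝ f q v) p w = fderiv ℝ (fderiv ℝ f) p w v := by
    intro v w
    rw [fderiv_clm_apply hd (differentiableAt_const v)]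
    simp
  have hs : IsSymmSndFDerivAt ℝ f p :=
    hf.contDiffAt.isSymmSndFDerivAt 
      (by simpa using WithTop.coe_le_coe.2 (le_top : (2 : ℕ∞) ≤ ⊤))
  unfold pd
  rw [key, key]
  exact hs _ _

theorem contDiff_Tc {n N : ℕ} {L : Fin (n+1) → Fin (n+1) → Fin N → J n N → ℝ}
    (hL : ∀ α β A, ContDiff ℝ (⊤ : ℕ∞) (L α β A)) (i j : Fin n) (A B : Fin N) :
    ContDiff ℝ (⊤ : ℕ∞) (Tc L i j A B) :=
  ((contDiff_pd (hL _ _ _) _ _).add (contDiff_pd (hL _ _ _) _ _)).sub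
    (contDiff_pd (hL _ _ _) _ _)

theorem pd_Tc {n N : ℕ} {L : Fin (n+1) → Fin (n+1) → Fin N → J n N → ℝ}
    (hL : ∀ α β A, ContDiff ℝ (⊤ : ℕ∞) (L α β A)) (i j : Fin n) (A B C : Fin N)
    (α : Fin (n+1)) (p : J n N) :
    pd C α (Tc L i j A B) p = pd C α (pd B i.succ (L 0 j.succ A)) p
      + pd C α (pd B j.succ (L 0 i.succ A)) p - pd C α (pd A 0 (L i.succ j.succ B)) p := by
  have h := fun α β A B γ => contDiff_pd (hL α β A) B γ
  unfold Tc
  rw [pd_sub ((h _ _ _ _ _).add (h _ _ _ _ _)) (h _ _ _ _ _), pd_add (h _ _ _ _ _) (h _ _ _ _ _)]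

/-- For a smooth family `T` symmetric in both index pairs, the first-order identity (c) implies
the second-order identity (d). -/
theorem second_order_of_first_order {n N : ℕ} {T : Fin n → Fin n → Fin N → Fin N → J n N → ℝ}
    (hT : ∀ i j A B, ContDiff ℝ (⊤ : ℕ∞) (T i j A B))
    (hupper : ∀ i j A B, T i j A B = T j i A B)
    (hlower : ∀ i j A B, T i j A B = T i j B A)
    (hc : ∀ i j k A B C p,
      pd C k.succ (T i j A B) p + pd B k.succ (T i j A C) p =
      pd A i.succ (T k j B C) p + pd A j.succ (T k i B C) p)
    (i j k l : Fin n) (A B C D : Fin N) (p : J n N) :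
    pd B i.succ (pd C j.succ (T k l A D)) p + pd B j.succ (pd C i.succ (T k l A D)) p =
    pd A k.succ (pd D l.succ (T i j B C)) p + pd A l.succ (pd D k.succ (T i j B C)) p := by
  have hdc : ∀ (i j k : Fin n) (A B C : Fin N) (E : Fin N) (m : Fin n),
      pd E m.succ (pd C k.succ (T i j A B)) p + pd E m.succ (pd B k.succ (T i j A C)) p =
      pd E m.succ (pd A i.succ (T k j B C)) p + pd E m.succ (pd A j.succ (T k i B C)) p := by
    intro i j k A B C E m
    have h := fun i j A B E m => contDiff_pd (hT i j A B) E m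
    rw [← pd_add (h _ _ _ _ _ _) (h _ _ _ _ _ _), ← pd_add (h _ _ _ _ _ _) (h _ _ _ _ _ _)]
    exact congrArg (fun f => pd E m.succ f p) (funext (hc i j k A B C))
  have hcomm := fun i j A B E F α β => pd_comm (hT i j A B) E F α β p
  linear_combination (norm := skip) hdc k j i D C B A l + hdc l k j A B D C i
    - hdc l k i A C B D j + hdc k l j A C D B i + hdc j l i D B C A k
  simp only [hcomm, hupper, hlower]
  ring

theorem step_ii_integrability (n N : ℕ) (hn : 0 < n) (hN : 0 < N)
    (L : Fin (n+1) → Fin (n+1) → Fin N → J n N → ℝ)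
    (hLsmooth : ∀ α β A, ContDiff ℝ (⊤ : ℕ∞) (L α β A))
    (hLsym : ∀ α β A, L α β A = L β α A)
    (hint1 : ∀ (μ ν ρ : Fin (n+1)) (A B : Fin N) (p : J n N),
      pd B ρ (L μ ν A) p + pd B μ (L ρ ν A) p + pd B ν (L μ ρ A) p =
      pd A ρ (L μ ν B) p + pd A μ (L ρ ν B) p + pd A ν (L μ ρ B) p)
    (hint2 : ∀ (μ ν ρ σ : Fin (n+1)) (A B C : Fin N) (p : J n N),
      pd B μ (fun q => pd C ρ (L σ ν A) q + pd C σ (L ρ ν A) q) p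
      + pd B ν (fun q => pd C ρ (L σ μ A) q + pd C σ (L ρ μ A) q) p
      - (pd A μ (pd B ν (L σ ρ C)) p + pd A ν (pd B μ (L σ ρ C)) p)
      - (pd A ρ (pd C σ (L μ ν B)) p + pd A σ (pd C ρ (L μ ν B)) p) = 0) :
    (∀ (i j : Fin n) (A B : Fin N) (p : J n N),
      Tc L i j A B p = Tc L j i A B p) ∧
    (∀ (i j : Fin n) (A B : Fin N) (p : J n N),
      Tc L i j A B p = Tc L i j B A p) ∧
    (∀ (i j k : Fin n) (A B C : Fin N) (p : J n N),
      pd C k.succ (Tc L i j A B) p + pd B k.succ (Tc L i j A C) p =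
      pd A i.succ (Tc L k j B C) p + pd A j.succ (Tc L k i B C) p) ∧
    (∀ (i j k l : Fin n) (A B C D : Fin N) (p : J n N),
      pd B i.succ (pd C j.succ (Tc L k l A D)) p
        + pd B j.succ (pd C i.succ (Tc L k l A D)) p =
      pd A k.succ (pd D l.succ (Tc L i j B C)) p
        + pd A l.succ (pd D k.succ (Tc L i j B C)) p) := by
  have hupper : ∀ i j A B, Tc L i j A B = Tc L j i A B := by
    intro i j A B
    funext p
    simp only [Tc, hLsym i.succ j.succ B]
    ring
  have hlower : ∀ i j A B, Tc L i j A B = Tc L i j B A := by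
    intro i j A B
    funext p
    simp only [Tc]
    have h := hint1 i.succ j.succ 0 A B p
    rw [hLsym i.succ 0 A, hLsym i.succ 0 B] at h
    linarith
  have hfirst : ∀ (i j k : Fin n) (A B C : Fin N) (p : J n N),
      pd C k.succ (Tc L i j A B) p + pd B k.succ (Tc L i j A C) p =
      pd A i.succ (Tc L k j B C) p + pd A j.succ (Tc L k i B C) p := by
    intro i j k A B C p
    have hcomm := fun α β A E F γ δ => pd_comm (hLsmooth α β A) E F γ δ p
    have hadd := fun α β A γ E α' β' A' γ' E' F δ =>
      pd_add (contDiff_pd (hLsmooth α β A) E γ) (contDiff_pd (hLsmooth α' β' A') E' γ') F δ p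
    have h := fun μ ν ρ σ A B C => hint2 μ ν ρ σ A B C p
    simp only [hadd] at h
    simp only [pd_Tc hLsmooth]
    linear_combination (norm := skip) -h 0 i.succ j.succ k.succ B A C
      - (1 / 2) * h 0 j.succ i.succ k.succ C A B - (1 / 2) * h 0 i.succ j.succ k.succ B C A
      + (1 / 2) * h 0 i.succ j.succ k.succ C B A - (1 / 2) * h 0 k.succ i.succ j.succ C A B
      - (1 / 2) * h 0 j.succ i.succ k.succ B A C + (1 / 2) * h 0 k.succ i.succ j.succ B A C
    simp only [hcomm, hLsym]
    ring
  exact ⟨fun i j A B => congrFun (hupper i j A B), fun i j A B => congrFun (hlower i j A B),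
    hfirst, second_order_of_first_order (contDiff_Tc hLsmooth) hupper hlower hfirst⟩
end
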